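/- arXiv:1907.05445 — 2 statements merged into one kernel-verified Lean document; each statement's English description precedes it below -/
import Mathlib

section
/- Let G be a finite connected distance-hereditary graph and let x,y be a mutually distant pair of vertices. If d(x,y) is odd, then every vertex u of G satisfies e(u) ≤ max{d(x,u), d(y,u)} + 1. -/
/-- A graph is distance-hereditary if every connected induced subgraph is isometric
(equivalently, every induced path is a shortest path). -/
def DistHereditary {V : Type*} (G : SimpleGraph V) : Prop :=
  ∀ s : Set V, (G.induce s).Connected →
    ∀ u v : s, (G.induce s).dist u v = G.dist (u : V) (v : V)

/-- Eccentricity of a vertex: `e(v) = max_{u} d(v,u)`. -/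
noncomputable def ecc {V : Type*} [Fintype V] (G : SimpleGraph V) (v : V) : ℕ :=
  Finset.univ.sup (fun u => G.dist v u)

/-- Radius: minimum eccentricity. -/
noncomputable def rad {V : Type*} [Fintype V] (G : SimpleGraph V) : ℕ :=
  sInf (Set.range (ecc G))

/-- Diameter: maximum eccentricity. -/
noncomputable def diam {V : Type*} [Fintype V] (G : SimpleGraph V) : ℕ :=
  Finset.univ.sup (fun v => ecc G v)

/-- The center: vertices of minimum eccentricity. -/
def center {V : Type*} [Fintype V] (G : SimpleGraph V) : Set V :=
  {v | ecc G v = rad G}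

/-- Distance from a vertex to a set of vertices: `d(v,S) = min_{s ∈ S} d(v,s)`. -/
noncomputable def distToSet {V : Type*} (G : SimpleGraph V) (v : V) (S : Set V) : ℕ :=
  sInf ((G.dist v) '' S)

/-- The interval `I(x,y)`: vertices on shortest `(x,y)`-paths. -/
def interval {V : Type*} (G : SimpleGraph V) (x y : V) : Set V :=
  {v | G.dist x v + G.dist v y = G.dist x y}

/-- The intervalSlice `S_k(x,y) = {v ∈ I(x,y) : d(x,v) = k}`. -/
def intervalSlice {V : Type*} (G : SimpleGraph V) (x y : V) (k : ℕ) : Set V :=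
  {v | v ∈ interval G x y ∧ G.dist x v = k}

/-- The set `S` induces a cograph in `G`: no induced path on four vertices within `S`. -/
def IsCographOn {V : Type*} (G : SimpleGraph V) (S : Set V) : Prop :=
  ¬ ∃ a b c d : V, a ∈ S ∧ b ∈ S ∧ c ∈ S ∧ d ∈ S ∧
    a ≠ c ∧ a ≠ d ∧ b ≠ d ∧
    G.Adj a b ∧ G.Adj b c ∧ G.Adj c d ∧ ¬ G.Adj a c ∧ ¬ G.Adj a d ∧ ¬ G.Adj b d

namespace SimpleGraph

variable {V : Type*} {G : SimpleGraph V}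

lemma Walk.le_add_length_of_adj_le {f : V → ℕ}
    (hf : ∀ s t, G.Adj s t → f t ≤ f s + 1) {a b : V} (p : G.Walk a b) :
    f b ≤ f a + p.length := by
  induction p with
  | nil => simp
  | cons h p ih =>
    have := hf _ _ h
    rw [Walk.length_cons]
    omega

lemma Walk.dist_add_dist_le_length {a b z : V} (p : G.Walk a b) (hz : z ∈ p.support) :
    G.dist a z + G.dist z b ≤ p.length := by
  classical
  have h₁ := dist_le (p.takeUntil z hz)
  have h₂ := dist_le (p.dropUntil z hz)
  have h₃ := congrArg Walk.length (p.take_spec hz)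
  rw [Walk.length_append] at h₃
  omega

lemma Connected.dist_add_dist_of_mem_geodesic (hG : G.Connected) {a b z : V} {p : G.Walk a b}
    (hp : p.length = G.dist a b) (hz : z ∈ p.support) :
    G.dist a z + G.dist z b = G.dist a b :=
  le_antisymm (hp ▸ p.dist_add_dist_le_length hz) hG.dist_triangle

/-- Vertices of a geodesic are at distance equal to the difference of their levels. -/
lemma Connected.dist_add_dist_or_of_mem_geodesic (hG : G.Connected) {a b z w : V} {p : G.Walk a b}
    (hp : p.length = G.dist a b) (hz : z ∈ p.support) (hw : w ∈ p.support) :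
    G.dist a z + G.dist z w = G.dist a w ∨ G.dist a w + G.dist z w = G.dist a z := by
  classical
  have h₁ := dist_le (p.takeUntil w hw)
  have h₂ := dist_le (p.dropUntil w hw)
  have h₃ := congrArg Walk.length (p.take_spec hw)
  rw [Walk.length_append] at h₃
  have h₄ := hG.dist_add_dist_of_mem_geodesic hp hw
  have h₅ := hG.dist_add_dist_of_mem_geodesic hp hz
  have hz' := hz
  rw [← p.take_spec hw, Walk.mem_support_append_iff] at hz'
  rcases hz' with hz' | hz'
  · have := Walk.dist_add_dist_le_length _ hz'
    have := hG.dist_triangle (u := a) (v := z) (w := w)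
    omega
  · have := Walk.dist_add_dist_le_length _ hz'
    have := hG.dist_triangle (u := a) (v := w) (w := z)
    rw [dist_comm (u := z) (v := w)]
    omega

lemma Connected.exists_geodesic_through (hG : G.Connected) {a b z : V}
    (hz : G.dist a z + G.dist z b = G.dist a b) :
    ∃ p : G.Walk a b, p.length = G.dist a b ∧ z ∈ p.support := by
  obtain ⟨p, hp⟩ := hG.exists_walk_length_eq_dist a z
  obtain ⟨q, hq⟩ := hG.exists_walk_length_eq_dist z b
  exact ⟨p.append q, by rw [Walk.length_append]; omega,
    (Walk.mem_support_append_iff p q).2 (Or.inl p.end_mem_support)⟩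

lemma Connected.exists_adj_dist_add_one (hG : G.Connected) {u a : V} (hne : u ≠ a) :
    ∃ p, G.Adj p a ∧ G.dist u p + 1 = G.dist u a := by
  obtain ⟨w, hw⟩ := hG.exists_walk_length_eq_dist a u
  cases w with
  | nil => exact absurd rfl hne
  | @cons _ p _ h w =>
    refine ⟨p, h.symm, ?_⟩
    have h₁ := dist_le w
    have h₂ := hG.dist_triangle (u := a) (v := p) (w := u)
    rw [dist_eq_one_iff_adj.2 h] at h₂
    rw [Walk.length_cons] at hw
    rw [dist_comm (u := u) (v := p), dist_comm (u := u) (v := a)]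
    omega

end SimpleGraph

namespace DistHereditary

open SimpleGraph

variable {V : Type*} {G : SimpleGraph V}

/-- A function that grows by at most one along the edges of a connected induced subgraph grows at
most as fast as the distance of the whole graph. -/
lemma le_add_dist (hdh : DistHereditary G) {S : Set V} (hS : (G.induce S).Connected) {f : V → ℕ}
    (hf : ∀ s ∈ S, ∀ t ∈ S, G.Adj s t → f t ≤ f s + 1) {a b : V} (ha : a ∈ S) (hb : b ∈ S) :
    f b ≤ f a + G.dist a b := by
  obtain ⟨w, hw⟩ := hS.exists_walk_length_eq_dist ⟨a, ha⟩ ⟨b, hb⟩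
  have := w.le_add_length_of_adj_le (f := fun s : S => f s) fun s t h => hf s s.2 t t.2 h
  rwa [hw, hdh S hS] at this

/-- All vertices of a connected set that are nearest to `u` have the same neighbours one step
closer to `u`. -/
lemma adj_of_nearest (hdh : DistHereditary G) (hG : G.Connected) {C : Set V}
    (hC : (G.induce C).Connected) {u a b p : V} (ha : a ∈ C) (hb : b ∈ C)
    (hmin : ∀ z ∈ C, G.dist u a ≤ G.dist u z) (hab : G.dist u b = G.dist u a)
    (hpa : G.Adj p a) (hp : G.dist u p + 1 = G.dist u a) : G.Adj p b := by
  classical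
  by_contra hpb
  obtain ⟨q, hq, hpq⟩ := hG.exists_geodesic_through (a := u) (b := a) (z := p)
    (by rw [dist_eq_one_iff_adj.2 hpa, hp])
  have hS := induce_union_connected hC.preconnected q.connected_induce_support.preconnected
    ⟨a, ha, q.end_mem_support⟩
  have hub : u ≠ b := by
    rintro rfl
    rw [SimpleGraph.dist_self] at hab
    omega
  have key := hdh.le_add_dist hS (f := fun z => if z = b then G.dist u a + 1 else G.dist u z)
    (a := u) (b := b) ?_ (Or.inr q.start_mem_support) (Or.inl hb)
  · simp only [if_true, if_neg hub, SimpleGraph.dist_self] at key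
    omega
  intro s hs t _ hst
  have htri := hG.dist_triangle (u := u) (v := s) (w := t)
  rw [dist_eq_one_iff_adj.2 hst] at htri
  by_cases ht : t = b
  · subst ht
    simp only [if_true, if_neg hst.ne]
    rcases hs with hs | hs
    · have := hmin s hs
      omega
    · by_contra hlt
      have hsp : G.dist s p = 0 := by
        have := hG.dist_add_dist_or_of_mem_geodesic hq hs hpq
        omega
      rw [hG.dist_eq_zero_iff] at hsp
      exact hpb (hsp ▸ hst)
  · by_cases hsb : s = b
    · subst hsb
      simp only [if_true, if_neg ht]
      omega
    · simp only [if_neg ht, if_neg hsb]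
      exact htri

/-- Projection of a vertex `u` to a geodesic from `x` to `y`: the first and the last nearest
vertices `a`, `b` are at most two apart and determine the distances from `u` to `x` and `y`. -/
lemma exists_projection (hdh : DistHereditary G) (hG : G.Connected) {x y : V} {w : G.Walk x y}
    (hw : w.length = G.dist x y) (u : V) :
    ∃ a ∈ w.support, ∃ b ∈ w.support, G.dist u b = G.dist u a ∧
      (∀ z ∈ w.support, G.dist u a ≤ G.dist u z) ∧
      G.dist x a ≤ G.dist x b ∧ G.dist x b ≤ G.dist x a + 2 ∧
      G.dist u x = G.dist u a + G.dist x a ∧ G.dist u y = G.dist u a + G.dist b y ∧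
      (G.dist x b = G.dist x a + 2 →
        ∃ p, G.dist x p + G.dist p y = G.dist x y ∧ G.dist u p < G.dist u a) := by
  classical
  have hfin : {z | z ∈ w.support}.Finite := w.support.finite_toSet
  obtain ⟨m, hm, hmin⟩ := Set.exists_min_image _ (G.dist u) hfin ⟨x, w.start_mem_support⟩
  have hfin' : {z | z ∈ w.support ∧ G.dist u z = G.dist u m}.Finite :=
    hfin.subset fun z hz => hz.1
  obtain ⟨a, ⟨ha, ham⟩, hamin⟩ := Set.exists_min_image _ (G.dist x) hfin' ⟨m, hm, rfl⟩
  obtain ⟨b, ⟨hb, hbm⟩, hbmax⟩ := Set.exists_max_image _ (G.dist x) hfin' ⟨m, hm, rfl⟩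
  simp only [Set.mem_ofPred_eq, and_imp, ← ham] at hmin hamin hbmax hbm
  have hle : G.dist x a ≤ G.dist x b := hamin b hb hbm
  have hxay := hG.dist_add_dist_of_mem_geodesic hw ha
  have hxby := hG.dist_add_dist_of_mem_geodesic hw hb
  refine ⟨a, ha, b, hb, hbm, hmin, hle, ?_⟩
  by_cases hua : u = a
  · subst hua
    rw [SimpleGraph.dist_self, hG.dist_eq_zero_iff] at hbm
    subst hbm
    simp [SimpleGraph.dist_comm]
  obtain ⟨p, hpa, hp⟩ := hG.exists_adj_dist_add_one hua
  have hpb := hdh.adj_of_nearest hG w.connected_induce_support ha hb hmin hbm hpa hp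
  have hxb := hG.dist_triangle (u := x) (v := a) (w := b)
  have hab := hG.dist_triangle (u := a) (v := p) (w := b)
  have hxp := hG.dist_triangle (u := x) (v := a) (w := p)
  have hpy := hG.dist_triangle (u := p) (v := b) (w := y)
  have hxpy := hG.dist_triangle (u := x) (v := p) (w := y)
  have h₁ := dist_eq_one_iff_adj.2 hpa.symm
  have h₂ := dist_eq_one_iff_adj.2 hpb
  obtain ⟨q, hq⟩ := hG.exists_walk_length_eq_dist u a
  have hS := induce_union_connected w.connected_induce_support.preconnected
    q.connected_induce_support.preconnected ⟨a, ha, q.end_mem_support⟩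
  have hlip : ∀ {z : V}, z ∈ w.support →
      G.dist u a + (G.dist x a - G.dist x z) + (G.dist x z - G.dist x b) ≤ G.dist u z := by
    intro z hz
    by_cases huw : u ∈ w.support
    · have := hmin u huw
      rw [SimpleGraph.dist_self] at this
      omega
    have key := hdh.le_add_dist hS (f := fun z => if z ∈ w.support then
        G.dist u a + (G.dist x a - G.dist x z) + (G.dist x z - G.dist x b) else G.dist u z)
      (a := u) (b := z) ?_ (Or.inr q.start_mem_support) (Or.inl hz)
    · simpa [huw, hz] using key
    intro s hs t ht hst
    have hust := hG.dist_triangle (u := u) (v := s) (w := t)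
    have huts := hG.dist_triangle (u := u) (v := t) (w := s)
    have hxst := hG.dist_triangle (u := x) (v := s) (w := t)
    have hxts := hG.dist_triangle (u := x) (v := t) (w := s)
    rw [dist_eq_one_iff_adj.2 hst] at hust hxst
    rw [dist_eq_one_iff_adj.2 hst.symm] at huts hxts
    have hnear : ∀ {r}, r ∈ w.support → G.dist u r ≤ G.dist u a →
        G.dist x a ≤ G.dist x r ∧ G.dist x r ≤ G.dist x b := fun {r} hr hra =>
      have h := le_antisymm hra (hmin r hr)
      ⟨hamin r hr h, hbmax r hr h⟩
    have hlow : ∀ {r}, r ∉ w.support → r ∈ q.support → G.dist u r < G.dist u a := by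
      intro r hr hrq
      have h := hG.dist_add_dist_of_mem_geodesic hq hrq
      have : G.dist r a ≠ 0 := fun h0 => hr ((hG.dist_eq_zero_iff.1 h0) ▸ ha)
      omega
    by_cases hsw : s ∈ w.support <;> by_cases htw : t ∈ w.support <;>
      simp only [if_pos, if_neg, hsw, htw, not_false_eq_true]
    · omega
    · have := hlow htw (ht.resolve_left htw)
      omega
    · have := hlow hsw (hs.resolve_left hsw)
      have := hmin t htw
      have := hnear htw (by omega)
      omega
    · exact hust
  have hux := hlip w.start_mem_support
  have huy := hlip w.end_mem_support
  have hux' := hG.dist_triangle (u := u) (v := a) (w := x)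
  have huy' := hG.dist_triangle (u := u) (v := b) (w := y)
  rw [SimpleGraph.dist_self] at hux
  rw [SimpleGraph.dist_comm (u := a) (v := x)] at hux'
  exact ⟨by omega, by omega, by omega, fun h => ⟨p, by omega, by omega⟩⟩

end DistHereditary

lemma dist_le_ecc {V : Type*} [Fintype V] (G : SimpleGraph V) (u v : V) :
    G.dist u v ≤ ecc G u :=
  Finset.le_sup (f := fun v => G.dist u v) (Finset.mem_univ v)

/-- If `x,y` are mutually distant and `d(x,y)` is odd, then every vertex `u`
satisfies `e(u) ≤ max{d(x,u), d(y,u)} + 1`. -/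
theorem ecc_one_approx_when_odd {V : Type*} [Fintype V] (G : SimpleGraph V)
    (hconn : G.Connected) (hdh : DistHereditary G) (x y : V)
    (hxy : G.dist x y = ecc G x) (hyx : G.dist y x = ecc G y)
    (hodd : Odd (G.dist x y)) :
    ∀ u : V, ecc G u ≤ max (G.dist x u) (G.dist y u) + 1 := by
  intro u
  refine Finset.sup_le fun v _ => ?_
  obtain ⟨z, hz, hzmin⟩ := Set.exists_min_image {z | G.dist x z + G.dist z y = G.dist x y}
    (G.dist u) (Set.toFinite _) ⟨x, by simp⟩
  -- a geodesic through a vertex of the interval nearest to `u`, so that the projection of `u` to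
  -- it has at most two levels
  obtain ⟨w, hw, hzw⟩ := hconn.exists_geodesic_through hz
  obtain ⟨a, ha, b, hb, hba, hmin, hle, hle₂, hux, huy, hp⟩ := hdh.exists_projection hconn hw u
  obtain ⟨a', ha', b', hb', hba', -, hle', hle₂', hvx, hvy, -⟩ :=
    hdh.exists_projection hconn hw v
  have hle₁ : G.dist x b ≤ G.dist x a + 1 := by
    by_contra h
    obtain ⟨p, hpI, hlt⟩ := hp (by omega)
    have := hzmin p hpI
    have := hmin z hzw
    omega
  have hvx' := dist_le_ecc G x v
  have hvy' := dist_le_ecc G y v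
  rw [← hxy, SimpleGraph.dist_comm] at hvx'
  rw [← hyx, SimpleGraph.dist_comm, SimpleGraph.dist_comm (u := y)] at hvy'
  rw [SimpleGraph.dist_comm (u := x) (v := u), SimpleGraph.dist_comm (u := y) (v := u)]
  have hyb := hconn.dist_add_dist_of_mem_geodesic hw hb
  have hyb' := hconn.dist_add_dist_of_mem_geodesic hw hb'
  have hya := hconn.dist_add_dist_of_mem_geodesic hw ha
  have hya' := hconn.dist_add_dist_of_mem_geodesic hw ha'
  have htri : ∀ c c', G.dist u v ≤ G.dist u c + G.dist c c' + G.dist v c' := by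
    intro c c'
    have h₁ := hconn.dist_triangle (u := u) (v := c) (w := v)
    have h₂ := hconn.dist_triangle (u := c) (v := c') (w := v)
    rw [SimpleGraph.dist_comm (u := c') (v := v)] at h₂
    omega
  have haa := htri a a'
  have hab := htri a b'
  have hba₁ := htri b a'
  have hbb := htri b b'
  have haa₁ := hconn.dist_add_dist_or_of_mem_geodesic hw ha ha'
  have hab₁ := hconn.dist_add_dist_or_of_mem_geodesic hw ha hb'
  have hba₂ := hconn.dist_add_dist_or_of_mem_geodesic hw hb ha'
  have hbb₁ := hconn.dist_add_dist_or_of_mem_geodesic hw hb hb'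
  obtain ⟨m, hm⟩ := hodd
  omega
end

section
/- Let G be a finite connected distance-hereditary graph, let v be an arbitrary vertex, and let v' be a vertex of C(G) closest to v. Then d(v, C(G)) + rad(G) − 1 ≤ e(v) ≤ d(v, C(G)) + rad(G). Furthermore, every shortest path P = (v' = x_0, x_1, ..., x_ℓ = v) from v' to v satisfies: (a) if e(v) = d(v, C(G)) + rad(G), then e(x_i) = i + rad(G) for each i ∈ {0,...,ℓ}; (b) if e(v) = d(v, C(G)) + rad(G) − 1, then e(x_i) = i − 1 + rad(G) for each i ∈ {3,...,ℓ} and e(x_1) = e(x_2) = rad(G) + 1. -/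
/-- A walk of length `G.dist u v` passes only through vertices of the interval from `u` to `v`. -/
lemma dist_add_dist_of_mem_support {V : Type*} {G : SimpleGraph V} (hconn : G.Connected)
    {u v x : V} (p : G.Walk u v) (hp : p.length = G.dist u v) (hx : x ∈ p.support) :
    G.dist u x + G.dist x v = G.dist u v := by
  classical
  have h := congrArg SimpleGraph.Walk.length (p.take_spec hx)
  rw [SimpleGraph.Walk.length_append] at h
  have h₁ := SimpleGraph.dist_le (p.takeUntil x hx)
  have h₂ := SimpleGraph.dist_le (p.dropUntil x hx)
  have h₃ := hconn.dist_triangle (u := u) (v := x) (w := v)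
  omega

/-- In a distance-hereditary graph, let `w` be a neighbor of `v` on a shortest path to `c`. If `u`
and `c` are too close to each other for a shortest path between them to come within distance one
of `v`, then `w` is closer to `u` than `v` is. -/
lemma DistHereditary.dist_add_one_le {V : Type*} {G : SimpleGraph V} (hconn : G.Connected)
    (hdh : DistHereditary G) {u v w c : V} (hvw : G.Adj v w)
    (hw : G.dist w c + 1 = G.dist v c)
    (hu : G.dist u c + 2 < G.dist v u + G.dist v c) :
    G.dist w u + 1 ≤ G.dist v u := by
  obtain ⟨p, hp⟩ := hconn.exists_walk_length_eq_dist w c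
  obtain ⟨q, hq⟩ := hconn.exists_walk_length_eq_dist c u
  let P : G.Walk v u := SimpleGraph.Walk.cons hvw (p.append q)
  have hcomm := G.dist_comm (u := u) (v := c)
  have huniq : ∀ x ∈ P.support, G.Adj v x → x = w := by
    intro x hx hvx
    have hd := SimpleGraph.dist_eq_one_iff_adj.2 hvx
    have tri₁ := hconn.dist_triangle (u := v) (v := x) (w := c)
    have tri₂ := hconn.dist_triangle (u := v) (v := x) (w := u)
    rw [SimpleGraph.Walk.support_cons, List.mem_cons, SimpleGraph.Walk.mem_support_append_iff] at hx
    rcases hx with rfl | hx | hx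
    · exact absurd hvx G.irrefl
    · have := dist_add_dist_of_mem_support hconn p hp hx
      exact ((hconn.dist_eq_zero_iff).1 (by omega : G.dist w x = 0)).symm
    · have := dist_add_dist_of_mem_support hconn q hq hx
      have := G.dist_comm (u := x) (v := c)
      omega
  have hS : (G.induce {x | x ∈ P.support}).Connected := P.connected_induce_support
  have hne : v ≠ u := by
    rintro rfl
    rw [SimpleGraph.dist_self] at hu
    omega
  obtain ⟨t, ht⟩ := hS.exists_walk_length_eq_dist ⟨v, P.start_mem_support⟩ ⟨u, P.end_mem_support⟩
  rw [hdh _ hS] at ht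
  cases t with
  | nil => exact absurd rfl hne
  | @cons _ y _ h t =>
    have hy : (y : V) = w := huniq y y.2 h
    have hle := SimpleGraph.dist_le (t.map (SimpleGraph.Embedding.induce _).toHom)
    rw [SimpleGraph.Walk.length_map] at hle
    rw [SimpleGraph.Walk.length_cons] at ht
    change G.dist (y : V) u ≤ _ at hle
    rw [hy] at hle
    change _ = G.dist v u at ht
    omega

lemma ecc_le_iff {V : Type*} [Fintype V] (G : SimpleGraph V) (u : V) (k : ℕ) :
    ecc G u ≤ k ↔ ∀ v, G.dist u v ≤ k := by
  simp [ecc]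

lemma rad_le_ecc {V : Type*} [Fintype V] (G : SimpleGraph V) (v : V) : rad G ≤ ecc G v :=
  Nat.sInf_le ⟨v, rfl⟩

lemma ecc_le_dist_add_ecc {V : Type*} [Fintype V] {G : SimpleGraph V} (hconn : G.Connected)
    (u v : V) : ecc G u ≤ G.dist u v + ecc G v :=
  (ecc_le_iff G u _).2 fun x =>
    hconn.dist_triangle.trans (Nat.add_le_add_left (dist_le_ecc G v x) _)

/-- At distance at least three from a central vertex `c`, a step along a shortest path
towards `c` from a noncentral vertex strictly decreases the eccentricity. -/
lemma DistHereditary.ecc_add_one_le {V : Type*} [Fintype V] {G : SimpleGraph V}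
    (hconn : G.Connected) (hdh : DistHereditary G) {v w c : V} (hc : c ∈ center G)
    (hv : v ∉ center G) (hvw : G.Adj v w) (hw : G.dist w c + 1 = G.dist v c)
    (hfar : 3 ≤ G.dist v c) : ecc G w + 1 ≤ ecc G v := by
  have hv' : rad G < ecc G v := lt_of_le_of_ne (rad_le_ecc G v) (Ne.symm hv)
  suffices ecc G w ≤ ecc G v - 1 by omega
  refine (ecc_le_iff G w _).2 fun u => ?_
  have hcu : G.dist u c ≤ rad G := by
    rw [G.dist_comm, ← show ecc G c = rad G from hc]
    exact dist_le_ecc G c u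
  have hvu := dist_le_ecc G v u
  by_cases h : rad G ≤ G.dist v u
  · have := hdh.dist_add_one_le hconn hvw hw (u := u) (by omega)
    omega
  · have tri := hconn.dist_triangle (u := w) (v := v) (w := u)
    have := SimpleGraph.dist_eq_one_iff_adj.2 hvw.symm
    omega

/-- The position of a vertex on a shortest path is its distance from the start. -/
lemma dist_getVert {V : Type*} {G : SimpleGraph V} (hconn : G.Connected) {u v : V}
    (p : G.Walk u v) (hp : p.length = G.dist u v) {i : ℕ} (hi : i ≤ p.length) :
    G.dist (p.getVert i) u = i ∧ G.dist v (p.getVert i) + i = p.length := by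
  have h₁ := SimpleGraph.dist_le (p.take i)
  have h₂ := SimpleGraph.dist_le (p.drop i)
  have h₃ := hconn.dist_triangle (u := u) (v := p.getVert i) (w := v)
  rw [SimpleGraph.Walk.take_length] at h₁
  rw [SimpleGraph.Walk.drop_length] at h₂
  rw [G.dist_comm (u := p.getVert i), G.dist_comm (u := v)]
  omega

/-- Along a shortest path from a closest central vertex, eccentricities grow by one at each step
from position two on. -/
lemma DistHereditary.ecc_getVert {V : Type*} [Fintype V] {G : SimpleGraph V}
    (hconn : G.Connected) (hdh : DistHereditary G) {v c : V} (hc : c ∈ center G)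
    (hclosest : G.dist v c = distToSet G v (center G)) (p : G.Walk c v)
    (hp : p.length = G.dist c v) :
    (∀ i, 1 ≤ i → i ≤ p.length → rad G + 1 ≤ ecc G (p.getVert i)) ∧
      ∀ i, 2 ≤ i → i ≤ p.length → ecc G v + i = ecc G (p.getVert i) + p.length := by
  have hnot : ∀ i, 1 ≤ i → i ≤ p.length → p.getVert i ∉ center G := by
    intro i hi hil hmem
    have h₁ : distToSet G v (center G) ≤ G.dist v (p.getVert i) :=
      Nat.sInf_le ⟨_, hmem, rfl⟩
    have h₂ := (dist_getVert hconn p hp hil).2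
    rw [G.dist_comm] at hp
    omega
  refine ⟨fun i hi hil => lt_of_le_of_ne (rad_le_ecc G _) (Ne.symm (hnot i hi hil)),
    fun i hi hil => le_antisymm ?_ ?_⟩
  · have h₁ := ecc_le_dist_add_ecc hconn v (p.getVert i)
    have h₂ := (dist_getVert hconn p hp hil).2
    omega
  · induction hil using Nat.decreasingInduction with
    | self => rw [p.getVert_length]
    | of_succ k hk ih =>
      have d₁ := (dist_getVert hconn p hp hk.le).1
      have d₂ := (dist_getVert hconn p hp (i := k + 1) hk).1
      have := ih (by omega)
      have := hdh.ecc_add_one_le hconn hc (hnot (k + 1) (by omega) hk)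
        (p.adj_getVert_succ hk).symm (by omega) (by omega)
      omega

/-- Let `v` be any vertex and `v'` a vertex of `C(G)` closest to `v`. Then
`d(v,C(G)) + rad(G) − 1 ≤ e(v) ≤ d(v,C(G)) + rad(G)`, and every shortest path
`(v' = x₀, x₁, ..., x_ℓ = v)` satisfies:
(a) if `e(v) = d(v,C(G)) + rad(G)` then `e(xᵢ) = i + rad(G)` for each `i ∈ {0,…,ℓ}`;
(b) if `e(v) = d(v,C(G)) + rad(G) − 1` then `e(xᵢ) = i − 1 + rad(G)` for each
`i ∈ {3,…,ℓ}` and `e(x₁) = e(x₂) = rad(G) + 1`. -/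
theorem all_shortest_paths_to_center {V : Type*} [Fintype V] (G : SimpleGraph V)
    (hconn : G.Connected) (hdh : DistHereditary G) (v v' : V)
    (hv' : v' ∈ center G) (hclosest : G.dist v v' = distToSet G v (center G)) :
    distToSet G v (center G) + rad G ≤ ecc G v + 1 ∧
    ecc G v ≤ distToSet G v (center G) + rad G ∧
    ∀ p : G.Walk v' v, p.IsPath → p.length = G.dist v' v →
      ((ecc G v = distToSet G v (center G) + rad G →
          ∀ i : ℕ, i ≤ p.length → ecc G (p.getVert i) = i + rad G) ∧
       (ecc G v + 1 = distToSet G v (center G) + rad G →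
          (∀ i : ℕ, 3 ≤ i → i ≤ p.length → ecc G (p.getVert i) + 1 = i + rad G) ∧
          ecc G (p.getVert 1) = rad G + 1 ∧ ecc G (p.getVert 2) = rad G + 1)) := by
  have hrad : ecc G v' = rad G := hv'
  have hupper := ecc_le_dist_add_ecc hconn v v'
  have hcomm := G.dist_comm (u := v) (v := v')
  refine ⟨?_, by omega, fun p _ hp => ?_⟩
  · obtain ⟨p, hp⟩ := hconn.exists_walk_length_eq_dist v' v
    obtain ⟨h₁, h₂⟩ := hdh.ecc_getVert hconn hv' hclosest p hp
    have hge := rad_le_ecc G v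
    by_cases hl : 2 ≤ p.length
    · have := h₁ 2 (by omega) hl
      have := h₂ 2 le_rfl hl
      omega
    · omega
  obtain ⟨h₁, h₂⟩ := hdh.ecc_getVert hconn hv' hclosest p hp
  have hle : ∀ i, i ≤ p.length → ecc G (p.getVert i) ≤ i + rad G := fun i hi => by
    have := ecc_le_dist_add_ecc hconn (p.getVert i) v'
    have := (dist_getVert hconn p hp hi).1
    omega
  refine ⟨fun he i hi => ?_, fun he => ?_⟩
  · have := hle i hi
    have := ecc_le_dist_add_ecc hconn v (p.getVert i)
    have := (dist_getVert hconn p hp hi).2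
    omega
  have hlen : 2 ≤ p.length := by
    by_contra! hlt
    have hge := rad_le_ecc G v
    have := h₁ p.length (by omega) le_rfl
    rw [p.getVert_length] at this
    omega
  refine ⟨fun i hi hil => ?_, ?_, ?_⟩
  · have := h₂ i (by omega) hil
    omega
  · have := h₁ 1 le_rfl (by omega)
    have := hle 1 (by omega)
    omega
  · have := h₂ 2 le_rfl hlen
    omega
end
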